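/- Let N=1 and p>1, and let B ⊂ ℝ be an interval of length 1. For every exponent α ∈ [0,2) and every constant C > 0, there exists ρ ∈ A with A(ρ) > 0 such that 𝒲_p(χ_B)^p − 𝒲_p(ρ)^p < C · A(ρ)^α. That is, the exponent 2 in the quantitative inequality 𝒲_p(χ_B)^p − 𝒲_p(ρ)^p ≥ C_p A(ρ)² cannot be replaced by any smaller exponent. -/

import Mathlib

open MeasureTheory ENNReal Set Metric Filter

noncomputable section

/-- Euclidean space `ℝ^N`. -/
abbrev Euc (N : ℕ) := EuclideanSpace ℝ (Fin N)

/-- The measure `ρ·γ` with density `ρ` with respect to `γ`. -/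
def densM {α : Type*} [MeasurableSpace α] (γ : Measure α) (ρ : α → ℝ) : Measure α :=
  γ.withDensity fun x => ENNReal.ofReal (ρ x)

/-- `π` is a transport plan (coupling) with marginals `μ` and `ν`. -/
def IsCoupling {α : Type*} [MeasurableSpace α] (π : Measure (α × α)) (μ ν : Measure α) : Prop :=
  π.map Prod.fst = μ ∧ π.map Prod.snd = ν

/-- Transport cost `∬ d(x,y)^p dπ(x,y)`. -/
def tCost {α : Type*} [MeasurableSpace α] [Dist α] (p : ℝ) (π : Measure (α × α)) : ℝ≥0∞ :=
  ∫⁻ z, ENNReal.ofReal (dist z.1 z.2 ^ p) ∂π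

/-- The `p`-th power `W_p(μ,ν)^p` of the `p`-Wasserstein distance. -/
def WpPow {α : Type*} [MeasurableSpace α] [Dist α] (p : ℝ) (μ ν : Measure α) : ℝ≥0∞ :=
  ⨅ (π : Measure (α × α)) (_ : IsCoupling π μ ν), tCost p π

/-- The `p`-Wasserstein distance `W_p(μ,ν)`. -/
def Wp {α : Type*} [MeasurableSpace α] [Dist α] (p : ℝ) (μ ν : Measure α) : ℝ≥0∞ :=
  WpPow p μ ν ^ (1 / p)

/-- `ρ'` is an admissible competitor for the energy `𝒲_p(ρ)`:
measurable, nonnegative, `ρ + ρ' ≤ 1` a.e., same total mass as `ρ`. -/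
def Adm {α : Type*} [MeasurableSpace α] (γ : Measure α) (ρ ρ' : α → ℝ) : Prop :=
  Measurable ρ' ∧ (∀ x, 0 ≤ ρ' x) ∧ (∀ᵐ x ∂γ, ρ x + ρ' x ≤ 1) ∧
    ∫⁻ x, ENNReal.ofReal (ρ' x) ∂γ = ∫⁻ x, ENNReal.ofReal (ρ x) ∂γ

/-- The `p`-th power `𝒲_p(ρ)^p` of the Wasserstein energy of a density `ρ`. -/
def WEnergyPow {α : Type*} [MeasurableSpace α] [Dist α] (p : ℝ) (γ : Measure α) (ρ : α → ℝ) :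
    ℝ≥0∞ :=
  ⨅ (ρ' : α → ℝ) (_ : Adm γ ρ ρ'), WpPow p (densM γ ρ) (densM γ ρ')

/-- The Wasserstein energy `𝒲_p(ρ) = inf { W_p(ργ, ρ'γ) : ρ' admissible }`. -/
def WEnergy {α : Type*} [MeasurableSpace α] [Dist α] (p : ℝ) (γ : Measure α) (ρ : α → ℝ) :
    ℝ≥0∞ :=
  WEnergyPow p γ ρ ^ (1 / p)

/-- The class `A_m` of densities with values in `[0,1]` and total mass `m`. -/
def memA {α : Type*} [MeasurableSpace α] (γ : Measure α) (m : ℝ) (ρ : α → ℝ) : Prop :=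
  Measurable ρ ∧ (∀ᵐ x ∂γ, 0 ≤ ρ x ∧ ρ x ≤ 1) ∧ ∫ x, ρ x ∂γ = m

/-- The class `AP_ρ` of admissible plans: first marginal `ργ`, second marginal `≤ (1-ρ)γ`. -/
def AP {α : Type*} [MeasurableSpace α] (γ : Measure α) (ρ : α → ℝ) (π : Measure (α × α)) : Prop :=
  π.map Prod.fst = densM γ ρ ∧ π.map Prod.snd ≤ densM γ fun x => 1 - ρ x

/-- `z` belongs to the support of the measure `μ`. -/
def inSupport {α : Type*} [TopologicalSpace α] [MeasurableSpace α] (μ : Measure α) (z : α) :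
    Prop :=
  ∀ U : Set α, IsOpen U → z ∈ U → 0 < μ U

/-- The asymmetry of a density on `ℝ`: the infimal `L¹` distance to characteristic
functions of intervals of length `1`. -/
def asym (ρ : ℝ → ℝ) : ℝ :=
  ⨅ x : ℝ, ∫ y, |ρ y - (Set.Ioo (x - 1/2) (x + 1/2)).indicator (fun _ => (1 : ℝ)) y|


lemma densM_ind (s : Set ℝ) (hs : MeasurableSet s) :
    densM volume (s.indicator fun _ => (1 : ℝ)) = volume.restrict s := by
  unfold densM
  have : (fun x => ENNReal.ofReal (s.indicator (fun _ => (1 : ℝ)) x)) = s.indicator 1 := by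
    ext x
    by_cases h : x ∈ s <;> simp [h]
  rw [this, withDensity_indicator_one hs]

lemma lint_ind (s : Set ℝ) (hs : MeasurableSet s) :
    ∫⁻ x, ENNReal.ofReal (s.indicator (fun _ => (1 : ℝ)) x) = volume s := by
  have : (fun x => ENNReal.ofReal (s.indicator (fun _ => (1 : ℝ)) x)) = s.indicator 1 := by
    ext x
    by_cases h : x ∈ s <;> simp [h]
  rw [this, lintegral_indicator_one hs]

lemma map_restrict_shift (d : ℝ) (s t : Set ℝ) (ht : MeasurableSet t)
    (h : s = (fun x => x + d) ⁻¹' t) :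
    (volume.restrict s).map (fun x => x + d) = volume.restrict t := by
  rw [h]
  exact ((measurePreserving_add_right volume d).restrict_preimage ht).map_eq

lemma ball_upper (p : ℝ) (a : ℝ) :
    WEnergyPow p volume ((Set.Ioo a (a + 1)).indicator fun _ => (1 : ℝ)) ≤
      ENNReal.ofReal ((1/2 : ℝ) ^ p) := by
  set s1 := Ioo a (a + 1/2) with hs1
  set s2 := Ico (a + 1/2) (a + 1) with hs2
  set t1 := Ioo (a + -(1/2)) a with ht1
  set t2 := Ico (a + 1) (a + 3/2) with ht2
  have hB : Ioo a (a+1) = s1 ∪ s2 := by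
    rw [hs1, hs2, Ioo_union_Ico_eq_Ioo] <;> linarith
  have hd : Disjoint s1 s2 := by
    rw [Set.disjoint_left]; intro x h1 h2
    exact absurd h1.2 (not_lt.2 h2.1)
  have hd' : Disjoint t1 t2 := by
    rw [Set.disjoint_left]; intro x h1 h2
    have := h1.2; have := h2.1; linarith
  have ms1 : MeasurableSet s1 := measurableSet_Ioo
  have ms2 : MeasurableSet s2 := measurableSet_Ico
  have mt1 : MeasurableSet t1 := measurableSet_Ioo
  have mt2 : MeasurableSet t2 := measurableSet_Ico
  have e1 : (volume.restrict s1).map (fun x => x + -(1/2)) = volume.restrict t1 := by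
    apply map_restrict_shift _ _ _ mt1
    ext x; simp only [hs1, ht1, mem_Ioo, mem_preimage]
    constructor <;> rintro ⟨h1, h2⟩ <;> constructor <;> linarith
  have e2 : (volume.restrict s2).map (fun x => x + (1/2)) = volume.restrict t2 := by
    apply map_restrict_shift _ _ _ mt2
    ext x; simp only [hs2, ht2, mem_Ico, mem_preimage]
    constructor <;> rintro ⟨h1, h2⟩ <;> constructor <;> linarith
  have hadm : Adm volume ((Set.Ioo a (a + 1)).indicator fun _ => (1 : ℝ))
      ((t1 ∪ t2).indicator fun _ => (1:ℝ)) := by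
    refine ⟨measurable_const.indicator (mt1.union mt2), ?_, ?_, ?_⟩
    · intro x; exact indicator_nonneg (fun _ _ => zero_le_one) x
    · refine Eventually.of_forall fun x => ?_
      by_cases h : x ∈ Ioo a (a+1)
      · have : x ∉ t1 ∪ t2 := by
          rintro (h' | h')
          · have := h'.2; have := h.1; linarith
          · have := h'.1; have := h.2; linarith
        simp [h, this]
      · rw [indicator_of_notMem h, zero_add]
        exact indicator_le_self' (fun _ _ => zero_le_one) x
    · rw [lint_ind _ (mt1.union mt2), lint_ind _ measurableSet_Ioo,
        measure_union hd' mt2, ht1, ht2, Real.volume_Ioo, Real.volume_Ico, Real.volume_Ioo,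
        ← ENNReal.ofReal_add] <;> ring_nf <;> norm_num
  unfold WEnergyPow
  refine le_trans (iInf₂_le _ hadm) ?_
  have mf1 : Measurable (fun x : ℝ => (x, x + -(1/2))) := by fun_prop
  have mf2 : Measurable (fun x : ℝ => (x, x + (1/2))) := by fun_prop
  have hc : IsCoupling ((volume.restrict s1).map (fun x : ℝ => (x, x + -(1/2))) +
      (volume.restrict s2).map (fun x : ℝ => (x, x + (1/2))))
      (densM volume ((Set.Ioo a (a + 1)).indicator fun _ => (1 : ℝ)))
      (densM volume ((t1 ∪ t2).indicator fun _ => (1:ℝ))) := by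
    rw [densM_ind _ measurableSet_Ioo, densM_ind _ (mt1.union mt2), hB]
    constructor
    · rw [Measure.map_add _ _ measurable_fst, Measure.map_map measurable_fst mf1,
        Measure.map_map measurable_fst mf2, Measure.restrict_union hd ms2]
      congr 1
      · exact Measure.map_id
      · exact Measure.map_id
    · rw [Measure.map_add _ _ measurable_snd, Measure.map_map measurable_snd mf1,
        Measure.map_map measurable_snd mf2, Measure.restrict_union hd' mt2, ← e1, ← e2]
      rfl
  unfold WpPow
  refine le_trans (iInf_le _ _) (le_trans (iInf_le _ hc) ?_)
  unfold tCost
  have mg : Measurable (fun z : ℝ × ℝ => ENNReal.ofReal (dist z.1 z.2 ^ p)) := by fun_prop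
  rw [lintegral_add_measure, lintegral_map mg mf1, lintegral_map mg mf2]
  have d1 : ∀ x : ℝ, dist x (x + -(1/2)) = 1/2 := by
    intro x; rw [Real.dist_eq]; ring_nf; norm_num
  have d2 : ∀ x : ℝ, dist x (x + (1/2)) = 1/2 := by
    intro x; rw [Real.dist_eq]; ring_nf; norm_num
  simp only [d1, d2, lintegral_const, Measure.restrict_apply_univ]
  rw [← mul_add, ← measure_union hd ms2, ← hB, Real.volume_Ioo]
  simp

lemma tangent (p : ℝ) (hp : 1 < p) (t : ℝ) (ht : 0 ≤ t) :
    (1/2:ℝ)^p + 2 * p * (1/2:ℝ)^p * (t - 1/2) ≤ t ^ p := by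
  have h := one_add_mul_self_le_rpow_one_add (s := 2*t - 1) (by linarith) hp.le
  have e : t ^ p = (1/2:ℝ)^p * (1 + (2*t-1))^p := by
    rw [← Real.mul_rpow (by norm_num) (by linarith)]; ring_nf
  rw [e]
  have h0 : 0 < (1/2:ℝ)^p := by positivity
  nlinarith

/-- the competitor -/
def rr (ε : ℝ) (x : ℝ) : ℝ :=
  1/2 * (Icc (-(1/2-ε)) (1/2-ε)).indicator (fun _ => (1:ℝ)) x +
  1/2 * (Icc (-(1/2+ε)) (1/2+ε)).indicator (fun _ => (1:ℝ)) x

lemma int_ind (f : ℝ → ℝ) (s : ℝ) (hs : 0 ≤ s) :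
    ∫ x, f x * (Icc (-s) s).indicator (fun _ => (1:ℝ)) x = ∫ x in (-s)..s, f x := by
  rw [intervalIntegral.integral_of_le (by linarith), ← integral_Icc_eq_integral_Ioc,
    ← integral_indicator measurableSet_Icc]
  congr 1; ext x
  by_cases h : x ∈ Icc (-s) s <;> simp [h]

lemma integrable_ind (f : ℝ → ℝ) (hf : Continuous f) (s : ℝ) :
    Integrable (fun x => f x * (Icc (-s) s).indicator (fun _ => (1:ℝ)) x) := by
  have : (fun x => f x * (Icc (-s) s).indicator (fun _ => (1:ℝ)) x) = (Icc (-s) s).indicator f := by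
    ext x
    by_cases h : x ∈ Icc (-s) s <;> simp [h]
  rw [this, integrable_indicator_iff measurableSet_Icc]
  exact hf.integrableOn_Icc

lemma int_abs (s : ℝ) (hs : 0 ≤ s) : ∫ x in (-s)..s, |x| = s^2 := by
  have i : ∀ u v : ℝ, IntervalIntegrable (fun x : ℝ => |x|) volume u v :=
    fun u v => continuous_abs.intervalIntegrable u v
  rw [← intervalIntegral.integral_add_adjacent_intervals (i (-s) 0) (i 0 s)]
  have h1 : ∫ x in (-s)..0, |x| = ∫ x in (-s)..0, -x := by
    apply intervalIntegral.integral_congr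
    intro x hx
    rw [uIcc_of_le (by linarith)] at hx
    exact abs_of_nonpos hx.2
  have h2 : ∫ x in (0:ℝ)..s, |x| = ∫ x in (0:ℝ)..s, x := by
    apply intervalIntegral.integral_congr
    intro x hx
    rw [uIcc_of_le (by linarith)] at hx
    exact abs_of_nonneg hx.1
  rw [h1, h2, intervalIntegral.integral_neg, integral_id, integral_id]; ring

lemma int_aff (A B s : ℝ) (hs : 0 ≤ s) :
    ∫ x, (A - B * |x|) * (Icc (-s) s).indicator (fun _ => (1:ℝ)) x = 2 * A * s - B * s^2 := by
  rw [int_ind _ _ hs, intervalIntegral.integral_sub, intervalIntegral.integral_const_mul,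
    int_abs s hs, intervalIntegral.integral_const]
  · simp; ring
  · exact continuous_const.intervalIntegrable _ _
  · exact (continuous_const.mul continuous_abs).intervalIntegrable _ _

lemma rr_meas (ε : ℝ) : Measurable (rr ε) := by
  unfold rr
  exact ((measurable_const.indicator measurableSet_Icc).const_mul _).add
    ((measurable_const.indicator measurableSet_Icc).const_mul _)

lemma ind_cases (s : Set ℝ) (x : ℝ) :
    0 ≤ s.indicator (fun _ => (1:ℝ)) x ∧ s.indicator (fun _ => (1:ℝ)) x ≤ 1 := by
  by_cases h : x ∈ s <;> simp [h]

lemma rr_bd (ε x : ℝ) : 0 ≤ rr ε x ∧ rr ε x ≤ 1 := by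
  unfold rr
  have h1 := ind_cases (Icc (-(1/2-ε)) (1/2-ε)) x
  have h2 := ind_cases (Icc (-(1/2+ε)) (1/2+ε)) x
  constructor <;> linarith [h1.1, h1.2, h2.1, h2.2]

lemma rr_aff_integrable (A B ε : ℝ) : Integrable (fun x => (A - B * |x|) * rr ε x) := by
  have e : (fun x => (A - B * |x|) * rr ε x) = fun x =>
    1/2 * ((A - B * |x|) * (Icc (-(1/2-ε)) (1/2-ε)).indicator (fun _ => (1:ℝ)) x) +
    1/2 * ((A - B * |x|) * (Icc (-(1/2+ε)) (1/2+ε)).indicator (fun _ => (1:ℝ)) x) := by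
    ext x; unfold rr; ring
  rw [e]
  exact ((integrable_ind _ (by fun_prop) _).const_mul _).add
    ((integrable_ind _ (by fun_prop) _).const_mul _)

lemma rr_aff (A B ε : ℝ) (h0 : 0 ≤ ε) (h1 : ε ≤ 1/2) :
    ∫ x, (A - B * |x|) * rr ε x = A - B * (1/4 + ε^2) := by
  have e : (fun x => (A - B * |x|) * rr ε x) = fun x =>
    1/2 * ((A - B * |x|) * (Icc (-(1/2-ε)) (1/2-ε)).indicator (fun _ => (1:ℝ)) x) +
    1/2 * ((A - B * |x|) * (Icc (-(1/2+ε)) (1/2+ε)).indicator (fun _ => (1:ℝ)) x) := by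
    ext x; unfold rr; ring
  rw [e, integral_add, integral_const_mul, integral_const_mul, int_aff _ _ _ (by linarith),
    int_aff _ _ _ (by linarith)]
  · ring
  · exact (integrable_ind _ (by fun_prop) _).const_mul _
  · exact (integrable_ind _ (by fun_prop) _).const_mul _

lemma rr_integrable (ε : ℝ) : Integrable (rr ε) := by
  simpa using rr_aff_integrable 1 0 ε

lemma rr_int (ε : ℝ) (h0 : 0 ≤ ε) (h1 : ε ≤ 1/2) : ∫ x, rr ε x = 1 := by
  simpa using rr_aff 1 0 ε h0 h1

lemma rr_asym (ε : ℝ) (h0 : 0 ≤ ε) (h1 : ε ≤ 1/2) : 2 * ε ≤ asym (rr ε) := by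
  unfold asym
  refine le_ciInf fun x => ?_
  have e1 := int_aff 1 0 (1/2-ε) (by linarith)
  have e2 := int_aff 1 0 (1/2+ε) (by linarith)
  have i1 := integrable_ind (fun _ => 1) (by fun_prop) (1/2-ε)
  have i2 := integrable_ind (fun _ => 1) (by fun_prop) (1/2+ε)
  simp only [zero_mul, sub_zero, one_mul] at e1 e2 i1 i2
  have : ∫ y, (1/2 * (Icc (-(1/2+ε)) (1/2+ε)).indicator (fun _ => (1:ℝ)) y
      - 1/2 * (Icc (-(1/2-ε)) (1/2-ε)).indicator (fun _ => (1:ℝ)) y) = 2 * ε := by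
    rw [integral_sub (i2.const_mul _) (i1.const_mul _), integral_const_mul, integral_const_mul,
      e1, e2]; ring
  rw [← this]
  apply integral_mono ((i2.const_mul _).sub (i1.const_mul _))
  · refine ((rr_integrable ε).sub ?_).abs
    rw [integrable_indicator_iff measurableSet_Ioo]
    simp
  · intro y
    simp only [rr, Pi.sub_apply]
    have hx : (Ioo (x - 1/2) (x + 1/2)).indicator (fun _ => (1:ℝ)) y = 0 ∨
      (Ioo (x - 1/2) (x + 1/2)).indicator (fun _ => (1:ℝ)) y = 1 := by
      by_cases h : y ∈ Ioo (x - 1/2) (x + 1/2)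
      · right; rw [indicator_of_mem h]
      · left; rw [indicator_of_notMem h]
    by_cases hy : y ∈ Icc (-(1/2-ε)) (1/2-ε)
    · have hy2 : y ∈ Icc (-(1/2+ε)) (1/2+ε) := ⟨by linarith [hy.1], by linarith [hy.2]⟩
      rw [indicator_of_mem hy, indicator_of_mem hy2]
      rw [sub_self]; positivity
    · rw [indicator_of_notMem hy]
      by_cases hy2 : y ∈ Icc (-(1/2+ε)) (1/2+ε)
      · rw [indicator_of_mem hy2]
        rcases hx with h | h <;> rw [h] <;> norm_num
      · rw [indicator_of_notMem hy2]
        rw [mul_zero, sub_self]; positivity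

lemma rr_lower (p : ℝ) (hp : 1 < p) (ε : ℝ) (h0 : 0 ≤ ε) (h1 : ε ≤ 1/2) :
    ENNReal.ofReal ((1/2:ℝ)^p - 4 * p * (1/2:ℝ)^p * ε^2) ≤ WEnergyPow p volume (rr ε) := by
  refine le_iInf₂ fun ρ' hρ' => le_iInf₂ fun π hπ => ?_
  obtain ⟨mρ, pρ, hle, -⟩ := hρ'
  obtain ⟨hf, hs⟩ := hπ
  set c := 2 * p * (1/2:ℝ)^p with hc
  have hc0 : 0 < c := by positivity
  set K := (1/2:ℝ)^p + c/2 with hK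
  have hlow : ENNReal.ofReal (K - c * (1/4 + ε^2)) ≤
      ∫⁻ x, ENNReal.ofReal (K - c * |x|) ∂(densM volume (rr ε)) := by
    unfold densM
    rw [lintegral_withDensity_eq_lintegral_mul _ (rr_meas ε).ennreal_ofReal (by fun_prop),
      ← rr_aff K c ε h0 h1]
    have hle2 : ENNReal.ofReal (∫ x, (K - c * |x|) * rr ε x) ≤
        ∫⁻ x, ENNReal.ofReal ((K - c * |x|) * rr ε x) := by
      rw [integral_eq_lintegral_pos_part_sub_lintegral_neg_part (rr_aff_integrable K c ε)]
      refine (ENNReal.ofReal_le_ofReal (sub_le_self _ ENNReal.toReal_nonneg)).trans ?_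
      exact ENNReal.ofReal_toReal_le
    refine hle2.trans ?_
    apply lintegral_mono
    intro x
    simp only [Pi.mul_apply]
    rw [mul_comm, ENNReal.ofReal_mul (rr_bd ε x).1]
  have hmid : ∫⁻ x, ENNReal.ofReal (K - c * |x|) ∂(densM volume (rr ε)) ≤
      tCost p π + ∫⁻ y, ENNReal.ofReal (c * (1 - |y|)) ∂(densM volume ρ') := by
    rw [← hf, ← hs, lintegral_map (by fun_prop) measurable_fst,
      lintegral_map (by fun_prop) measurable_snd]
    unfold tCost
    rw [← lintegral_add_left (by fun_prop)]
    apply lintegral_mono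
    intro z
    refine le_trans (ENNReal.ofReal_le_ofReal ?_) ENNReal.ofReal_add_le
    have ht := tangent p hp (dist z.1 z.2) dist_nonneg
    have hab : |z.2| - |z.1| ≤ dist z.1 z.2 := by
      rw [dist_comm, Real.dist_eq]; exact abs_sub_abs_le_abs_sub _ _
    have := mul_le_mul_of_nonneg_left hab hc0.le
    rw [← hc] at ht
    rw [hK]
    nlinarith
  have hup : ∫⁻ y, ENNReal.ofReal (c * (1 - |y|)) ∂(densM volume ρ') ≤
      ENNReal.ofReal (c * (1/4 + ε^2)) := by
    set g : ℝ → ℝ := fun y => (c - c * |y|) * (Icc (-1) 1).indicator (fun _ => (1:ℝ)) y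
      - (c - c * |y|) * rr ε y with hg
    have hgpt : ∀ y, g y = ((Icc (-1) 1).indicator (fun _ => (1:ℝ)) y) * (c * (1 - |y|)) * (1 - rr ε y) := by
      intro y
      simp only [hg]
      by_cases hy : y ∈ Icc (-1:ℝ) 1
      · rw [indicator_of_mem hy]; ring
      · have : rr ε y = 0 := by
          unfold rr
          rw [indicator_of_notMem, indicator_of_notMem]
          · simp
          · exact fun h => hy ⟨by linarith [h.1], by linarith [h.2]⟩
          · exact fun h => hy ⟨by linarith [h.1], by linarith [h.2]⟩
        rw [this, indicator_of_notMem hy]; ring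
    have hgi : Integrable g := (integrable_ind _ (by fun_prop) 1).sub (rr_aff_integrable c c ε)
    have hgint : ∫ y, g y = c * (1/4 + ε^2) - 0 := by
      rw [hg, integral_sub (integrable_ind _ (by fun_prop) 1) (rr_aff_integrable c c ε),
        rr_aff _ _ _ h0 h1, int_aff _ _ _ zero_le_one]
      ring
    have hg0 : 0 ≤ g := by
      intro y
      rw [hgpt]
      by_cases hy : y ∈ Icc (-1:ℝ) 1
      · rw [indicator_of_mem hy]
        have : |y| ≤ 1 := abs_le.2 hy
        have h2 := (rr_bd ε y).2
        have : 0 ≤ 1 - |y| := by linarith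
        have : 0 ≤ 1 - rr ε y := by linarith
        show 0 ≤ _
        positivity
      · rw [indicator_of_notMem hy]; simp
    rw [sub_zero] at hgint
    rw [← hgint, ofReal_integral_eq_lintegral_ofReal hgi (Eventually.of_forall hg0)]
    unfold densM
    rw [lintegral_withDensity_eq_lintegral_mul _ mρ.ennreal_ofReal (by fun_prop)]
    apply lintegral_mono_ae
    filter_upwards [hle] with y hy
    simp only [Pi.mul_apply]
    rw [hgpt]
    by_cases hy1 : y ∈ Icc (-1:ℝ) 1
    · rw [indicator_of_mem hy1, ← ENNReal.ofReal_mul (pρ y)]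
      apply ENNReal.ofReal_le_ofReal
      have : |y| ≤ 1 := abs_le.2 hy1
      have : 0 ≤ c * (1 - |y|) := mul_nonneg hc0.le (by linarith)
      nlinarith
    · have : 1 ≤ |y| := by
        by_contra h
        exact hy1 (abs_le.1 (not_le.1 h).le)
      rw [ENNReal.ofReal_of_nonpos (p := c * (1 - |y|)) (by nlinarith)]
      simp
  have key := hlow.trans (hmid.trans (add_le_add_right hup _))
  have : (1/2:ℝ)^p - 4 * p * (1/2:ℝ)^p * ε^2 = (K - c * (1/4 + ε^2)) - c * (1/4 + ε^2) := by
    rw [hK, hc]; ring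
  rw [this, ENNReal.ofReal_sub _ (by positivity)]
  exact tsub_le_iff_right.2 key

/-- Sharpness of the exponent `2` in the quantitative inequality: for every exponent
`α < 2` and every constant `C > 0` there is `ρ ∈ A` with positive asymmetry such that
`𝒲_p(χ_B)^p − 𝒲_p(ρ)^p < C·A(ρ)^α`. -/
theorem quantitative_exponent_sharp (p : ℝ) (hp : 1 < p) (a : ℝ)
    (α : ℝ) (hα₀ : 0 ≤ α) (hα₂ : α < 2) (C : ℝ) (hC : 0 < C) :
    ∃ ρ : ℝ → ℝ, memA volume 1 ρ ∧ 0 < asym ρ ∧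
      WEnergyPow p volume ((Set.Ioo a (a + 1)).indicator fun _ => (1 : ℝ)) <
        WEnergyPow p volume ρ + ENNReal.ofReal (C * asym ρ ^ α) := by
  set D := 4 * p * (1/2:ℝ)^p with hD
  have hD0 : 0 < D := by positivity
  obtain ⟨ε, h0, h1, h2⟩ : ∃ ε : ℝ, 0 < ε ∧ ε ≤ 1/2 ∧ ε ^ (2 - α) < C / D := by
    have ht : Tendsto (fun x : ℝ => x ^ (2 - α)) (nhdsWithin 0 (Ioi 0)) (nhds 0) := by
      have := (Real.continuousAt_rpow_const 0 (2 - α) (Or.inr (by linarith))).tendsto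
      rw [Real.zero_rpow (by linarith)] at this
      exact this.mono_left nhdsWithin_le_nhds
    have hev := ht.eventually (gt_mem_nhds (show 0 < C / D by positivity))
    have hI : ∀ᶠ x : ℝ in nhdsWithin 0 (Ioi 0), x ∈ Ioc (0:ℝ) (1/2) :=
      Ioc_mem_nhdsGT (by norm_num)
    obtain ⟨ε, he, hi⟩ := (hev.and hI).exists
    exact ⟨ε, hi.1, hi.2, he⟩
  have has := rr_asym ε h0.le h1
  refine ⟨rr ε, ⟨rr_meas ε, Eventually.of_forall (rr_bd ε), rr_int ε h0.le h1⟩,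
    by linarith, ?_⟩
  have hkey : D * ε^2 < C * asym (rr ε) ^ α := by
    have e : ε^2 = ε^(2-α) * ε^α := by
      rw [← Real.rpow_add h0, ← Real.rpow_natCast]; norm_num
    have hm : ε^α ≤ asym (rr ε) ^ α := Real.rpow_le_rpow h0.le (by linarith) hα₀
    have hpos : 0 < ε^α := by positivity
    rw [lt_div_iff₀ hD0] at h2
    calc D * ε^2 = (ε^(2-α) * D) * ε^α := by rw [e]; ring
      _ < C * ε^α := by gcongr
      _ ≤ _ := by gcongr
  refine (ball_upper p a).trans_lt ?_
  refine lt_of_lt_of_le ?_ (add_le_add_left (rr_lower p hp ε h0.le h1) _)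
  refine lt_of_lt_of_le ?_ ENNReal.ofReal_add_le
  rw [← hD]
  have : 0 < (1/2:ℝ)^p := by positivity
  rw [ENNReal.ofReal_lt_ofReal_iff] <;> linarith
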